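/- Let H be a monoid. Then H admits a divisor homomorphism φ : H → F(P) into a free abelian monoid F(P) (the commutative monoid of finitely supported functions P → ℕ over some set P) if and only if H is a normalizing Krull monoid. -/

import Mathlib

open scoped Pointwise

/-- `H` is a submonoid of the group `G` such that `G` is a left and a right
quotient group of `H` (i.e. `H` is a cancellative semigroup satisfying both
Ore conditions, embedded in its quotient group `G = q(H)`). -/
def IsQG {G : Type*} [Group G] (H : Submonoid G) : Prop :=
  (∀ g : G, ∃ a ∈ H, ∃ b ∈ H, g = a⁻¹ * b) ∧ (∀ g : G, ∃ c ∈ H, ∃ d ∈ H, g = c * d⁻¹)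

/-- Left quotient `(A :ₗ B) = {x ∈ G | x B ⊆ A}`. -/
def lq {G : Type*} [Group G] (A B : Set G) : Set G := {x | ∀ b ∈ B, x * b ∈ A}

/-- Right quotient `(A :ᵣ B) = {x ∈ G | B x ⊆ A}`. -/
def rq {G : Type*} [Group G] (A B : Set G) : Set G := {x | ∀ b ∈ B, b * x ∈ A}

/-- A fractional ideal of `H`: a two-sided `H`-module `𝔞 ⊆ G = q(H)` with
`c𝔞 ⊆ H` and `𝔞d ⊆ H` for some `c, d ∈ H`. -/
def IsFracIdeal {G : Type*} [Group G] (H : Submonoid G) (a : Set G) : Prop :=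
  (H : Set G) * a = a ∧ a * (H : Set G) = a ∧
  (∃ c ∈ H, ∀ x ∈ a, c * x ∈ H) ∧ (∃ d ∈ H, ∀ x ∈ a, x * d ∈ H)

/-- An ideal of `H`: a two-sided `H`-module contained in `H`. -/
def IsIdeal {G : Type*} [Group G] (H : Submonoid G) (a : Set G) : Prop :=
  a ⊆ (H : Set G) ∧ (H : Set G) * a = a ∧ a * (H : Set G) = a

/-- The divisorial closure `𝔞_v = (H :ₗ (H :ᵣ 𝔞))`. -/
def vOp {G : Type*} [Group G] (H : Submonoid G) (a : Set G) : Set G :=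
  lq (H : Set G) (rq (H : Set G) a)

/-- `H` is completely integrally closed:
`(𝔞 :ₗ 𝔞) = (𝔞 :ᵣ 𝔞) = H` for every non-empty ideal `𝔞` of `H`. -/
def IsCIC {G : Type*} [Group G] (H : Submonoid G) : Prop :=
  ∀ a : Set G, IsIdeal H a → a.Nonempty → lq a a = (H : Set G) ∧ rq a a = (H : Set G)

/-- A divisorial ideal of `H`: an ideal `𝔞` with
`𝔞 = (H :ₗ (H :ᵣ 𝔞)) = (H :ᵣ (H :ₗ 𝔞))`. -/
def IsDivIdealFull {G : Type*} [Group G] (H : Submonoid G) (a : Set G) : Prop :=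
  IsIdeal H a ∧ a = lq (H : Set G) (rq (H : Set G) a) ∧
    a = rq (H : Set G) (lq (H : Set G) a)

/-- `H` is v-noetherian: the ascending chain condition on divisorial ideals. -/
def VNoethFull {G : Type*} [Group G] (H : Submonoid G) : Prop :=
  ∀ f : ℕ → Set G, (∀ n, IsDivIdealFull H (f n)) → (∀ n, f n ⊆ f (n + 1)) →
    ∃ N, ∀ n, N ≤ n → f n = f N

/-- `H` is a Krull monoid: completely integrally closed and v-noetherian. -/
def IsKrull {G : Type*} [Group G] (H : Submonoid G) : Prop :=
  IsCIC H ∧ VNoethFull H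

section DivisorHom

variable {G P : Type*} [Group G] {H : Submonoid G} {φ : H → (P →₀ ℕ)}

/-- A finite subset of `A` realises the pointwise minimum of `φ` on `A`. -/
lemma exists_finset_minimizing {α P : Type*} (f : α → (P →₀ ℕ)) {A : Set α} (hA : A.Nonempty) :
    ∃ E : Finset α, ↑E ⊆ A ∧ ∀ a ∈ A, ∀ p, ∃ e ∈ E, f e p ≤ f a p := by
  classical
  obtain ⟨a₀, ha₀⟩ := hA
  have hmin : ∀ p, ∃ e ∈ A, ∀ a ∈ A, f e p ≤ f a p := fun p ↦ by
    obtain ⟨e, he, hmin⟩ := exists_minimalFor_of_wellFoundedLT (· ∈ A) (fun a ↦ f a p) ⟨a₀, ha₀⟩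
    exact ⟨e, he, fun a ha ↦ (le_total (f e p) (f a p)).elim id (hmin ha)⟩
  choose m hmA hm using hmin
  refine ⟨insert a₀ ((f a₀).support.image m), ?_, fun a ha p ↦ ?_⟩
  · intro x hx
    simp only [Finset.coe_insert, Finset.coe_image, Set.mem_insert_iff, Set.mem_image] at hx
    rcases hx with rfl | ⟨p, -, rfl⟩
    · exact ha₀
    · exact hmA p
  · by_cases hp : p ∈ (f a₀).support
    · exact ⟨m p, by simp only [Finset.mem_insert, Finset.mem_image]; exact .inr ⟨p, hp, rfl⟩,
        hm p a ha⟩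
    · exact ⟨a₀, by simp, by simp [Finsupp.notMem_support_iff.mp hp]⟩

lemma singleton_mul_eq_of_divisorHom (hmul : ∀ a b : H, φ (a * b) = φ a + φ b)
    (hleft : ∀ v u : H, φ u ≤ φ v → ∃ h : H, v = u * h)
    (hright : ∀ v u : H, φ u ≤ φ v → ∃ h : H, v = h * u) {a : G} (ha : a ∈ H) :
    ({a} : Set G) * (H : Set G) = (H : Set G) * {a} := by
  ext x
  simp only [Set.singleton_mul, Set.mul_singleton, Set.mem_image, SetLike.mem_coe]
  constructor
  · rintro ⟨h, hh, rfl⟩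
    obtain ⟨k, hk⟩ := hright (⟨a, ha⟩ * ⟨h, hh⟩) ⟨a, ha⟩ (by rw [hmul]; exact le_self_add)
    exact ⟨k, k.2, (congrArg Subtype.val hk).symm⟩
  · rintro ⟨h, hh, rfl⟩
    obtain ⟨k, hk⟩ := hleft (⟨h, hh⟩ * ⟨a, ha⟩) ⟨a, ha⟩ (by rw [hmul]; exact le_add_self)
    exact ⟨k, k.2, (congrArg Subtype.val hk).symm⟩

/-- If `c + b (n + 1) = d + b n` for all `n`, then `c ≤ d`. -/
lemma le_of_add_succ_eq {c d : P →₀ ℕ} {b : ℕ → (P →₀ ℕ)}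
    (h : ∀ n, c + b (n + 1) = d + b n) : c ≤ d := by
  intro p
  have key : ∀ n, n * c p + b n p = n * d p + b 0 p := fun n ↦ by
    induction n with
    | zero => simp
    | succ n ih =>
      have := DFunLike.congr_fun (h n) p
      simp only [Finsupp.add_apply] at this
      linarith
  by_contra! hlt
  have := key (b 0 p + 1)
  nlinarith

lemma isCIC_of_divisorHom (hq : IsQG H) (hmul : ∀ a b : H, φ (a * b) = φ a + φ b)
    (hleft : ∀ v u : H, φ u ≤ φ v → ∃ h : H, v = u * h)
    (hright : ∀ v u : H, φ u ≤ φ v → ∃ h : H, v = h * u) : IsCIC H := by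
  rintro A ⟨hAH, hHA, hAmul⟩ ⟨a, ha⟩
  refine ⟨Set.Subset.antisymm (fun x hx ↦ ?_) fun x hx b hb ↦ ?_,
    Set.Subset.antisymm (fun x hx ↦ ?_) fun x hx b hb ↦ ?_⟩
  · have hb : ∀ n : ℕ, x ^ n * a ∈ A := fun n ↦ by
      induction n with
      | zero => simpa using ha
      | succ n ih => simpa [pow_succ', mul_assoc] using hx _ ih
    obtain ⟨c, hc, d, hd, rfl⟩ := hq.1 x
    obtain ⟨k, hk⟩ := hleft ⟨d, hd⟩ ⟨c, hc⟩
      (le_of_add_succ_eq (b := fun n ↦ φ ⟨_, hAH (hb n)⟩) fun n ↦ by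
        rw [← hmul, ← hmul]
        congr 1
        ext
        simp [pow_succ', mul_assoc])
    have : d = c * k := congrArg Subtype.val hk
    simp [this]
  · rw [← hHA]
    exact Set.mul_mem_mul hx hb
  · have hb : ∀ n : ℕ, a * x ^ n ∈ A := fun n ↦ by
      induction n with
      | zero => simpa using ha
      | succ n ih => simpa [pow_succ, mul_assoc] using hx _ ih
    obtain ⟨d, hd, c, hc, rfl⟩ := hq.2 x
    obtain ⟨k, hk⟩ := hright ⟨d, hd⟩ ⟨c, hc⟩
      (le_of_add_succ_eq (b := fun n ↦ φ ⟨_, hAH (hb n)⟩) fun n ↦ by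
        rw [add_comm (φ _), ← hmul, add_comm (φ ⟨d, hd⟩), ← hmul]
        congr 1
        ext
        simp [pow_succ, mul_assoc])
    have : d = k * c := congrArg Subtype.val hk
    simp [this]
  · rw [← hAmul]
    exact Set.mul_mem_mul hb hx

lemma vNoethFull_of_divisorHom (hq : IsQG H) (hmul : ∀ a b : H, φ (a * b) = φ a + φ b)
    (hright : ∀ v u : H, φ u ≤ φ v → ∃ h : H, v = h * u) : VNoethFull H := by
  intro f hf hsucc
  have hmono : Monotone f := monotone_nat_of_le_succ hsucc
  have hfH : ∀ n, f n ⊆ H := fun n ↦ (hf n).1.1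
  let A : Set H := {a | ∃ n, (a : G) ∈ f n}
  rcases A.eq_empty_or_nonempty with hA | hA
  · have hempty : ∀ n, f n = ∅ := fun n ↦ Set.eq_empty_of_forall_notMem fun x hx ↦
      Set.eq_empty_iff_forall_notMem.mp hA ⟨x, hfH n hx⟩ ⟨n, hx⟩
    exact ⟨0, fun n _ ↦ by rw [hempty, hempty]⟩
  obtain ⟨E, hEA, hE⟩ := exists_finset_minimizing φ hA
  choose! k hk using fun e (he : e ∈ E) ↦ hEA he
  refine ⟨E.sup k, fun n hn ↦ Set.Subset.antisymm ?_ (hmono hn)⟩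
  rw [(hf (E.sup k)).2.1]
  intro a ha x hx
  obtain ⟨c, hc, d, hd, rfl⟩ := hq.2 x
  obtain ⟨h, hh⟩ := hright (⟨a, hfH n ha⟩ * ⟨c, hc⟩) ⟨d, hd⟩ fun p ↦ by
    obtain ⟨e, heE, he⟩ := hE ⟨a, hfH n ha⟩ ⟨n, ha⟩ p
    have hmem : (e : G) * (c * d⁻¹) ∈ H := hx e (hmono (Finset.le_sup heE) (hk e heE))
    have heq : e * ⟨c, hc⟩ = ⟨_, hmem⟩ * ⟨d, hd⟩ := by ext; simp [mul_assoc]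
    have := DFunLike.congr_fun (congrArg φ heq) p
    simp only [hmul, Finsupp.add_apply] at this ⊢
    omega
  have : a * c = h * d := congrArg Subtype.val hh
  rw [SetLike.mem_coe, ← mul_assoc, this, mul_inv_cancel_right]
  exact h.2

end DivisorHom

section Normalizing

variable {G : Type*} [Group G] {H : Submonoid G}

lemma conj_mem_of_normalizing (hq : IsQG H)
    (hn : ∀ a ∈ H, ({a} : Set G) * (H : Set G) = (H : Set G) * {a}) (g : G) {h : G}
    (hh : h ∈ H) : g * h * g⁻¹ ∈ H := by
  have hpos : ∀ a ∈ H, ∀ h ∈ H, a * h * a⁻¹ ∈ H := fun a ha h hh ↦ by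
    have : a * h ∈ (H : Set G) * {a} := hn a ha ▸ Set.mul_mem_mul rfl hh
    obtain ⟨k, hk, _, rfl, hka⟩ := this
    rw [← hka]
    simpa using hk
  have hneg : ∀ a ∈ H, ∀ h ∈ H, a⁻¹ * h * a ∈ H := fun a ha h hh ↦ by
    have : h * a ∈ ({a} : Set G) * (H : Set G) := hn a ha ▸ Set.mul_mem_mul hh rfl
    obtain ⟨_, rfl, k, hk, hka⟩ := this
    rw [mul_assoc, ← hka]
    simpa using hk
  obtain ⟨a, ha, b, hb, rfl⟩ := hq.1 g
  simpa [mul_assoc] using hneg a ha _ (hpos b hb h hh)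

lemma mul_mem_comm (hN : ∀ g : G, ∀ h ∈ H, g * h * g⁻¹ ∈ H) {x y : G} (h : x * y ∈ H) :
    y * x ∈ H := by
  simpa [mul_assoc] using hN y _ h

lemma lq_eq_rq (hN : ∀ g : G, ∀ h ∈ H, g * h * g⁻¹ ∈ H) (B : Set G) :
    lq (H : Set G) B = rq (H : Set G) B :=
  Set.ext fun _ ↦ forall₂_congr fun _ _ ↦ ⟨mul_mem_comm hN, mul_mem_comm hN⟩

lemma IsIdeal.mul_mem_left {A : Set G} (hA : IsIdeal H A) {h x : G} (hh : h ∈ H) (hx : x ∈ A) :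
    h * x ∈ A :=
  hA.2.1 ▸ Set.mul_mem_mul hh hx

lemma IsIdeal.mul_mem_right {A : Set G} (hA : IsIdeal H A) {h x : G} (hh : h ∈ H) (hx : x ∈ A) :
    x * h ∈ A :=
  hA.2.2 ▸ Set.mul_mem_mul hx hh

lemma isIdeal_of_mul_mem {A : Set G} (hAH : A ⊆ H) (hl : ∀ h ∈ H, ∀ x ∈ A, h * x ∈ A)
    (hr : ∀ h ∈ H, ∀ x ∈ A, x * h ∈ A) : IsIdeal H A := by
  refine ⟨hAH, Set.Subset.antisymm ?_ fun x hx ↦ ⟨1, H.one_mem, x, hx, one_mul x⟩,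
    Set.Subset.antisymm ?_ fun x hx ↦ ⟨x, hx, 1, H.one_mem, mul_one x⟩⟩
  · rintro _ ⟨h, hh, x, hx, rfl⟩
    exact hl h hh x hx
  · rintro _ ⟨x, hx, h, hh, rfl⟩
    exact hr h hh x hx

lemma lq_lq_lq (hN : ∀ g : G, ∀ h ∈ H, g * h * g⁻¹ ∈ H) (B : Set G) :
    lq (H : Set G) (lq (H : Set G) (lq (H : Set G) B)) = lq (H : Set G) B :=
  Set.Subset.antisymm (fun _ hx b hb ↦ hx b fun _ hz ↦ mul_mem_comm hN (hz b hb))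
    fun _ hx _ hy ↦ mul_mem_comm hN (hy _ hx)

lemma isDivIdealFull_lq (hN : ∀ g : G, ∀ h ∈ H, g * h * g⁻¹ ∈ H) {B : Set G} (hB : 1 ∈ B) :
    IsDivIdealFull H (lq (H : Set G) B) := by
  refine ⟨isIdeal_of_mul_mem (fun x hx ↦ by simpa using hx 1 hB) (fun h hh x hx b hb ↦ ?_)
    fun h hh x hx b hb ↦ ?_, ?_, ?_⟩
  · rw [mul_assoc]
    exact H.mul_mem hh (hx b hb)
  · have := H.mul_mem (hx b hb) (hN b⁻¹ h hh)
    simpa [mul_assoc] using this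
  · rw [← lq_eq_rq hN, lq_lq_lq hN]
  · rw [← lq_eq_rq hN, lq_lq_lq hN]

lemma IsDivIdealFull.lq_lq (hN : ∀ g : G, ∀ h ∈ H, g * h * g⁻¹ ∈ H) {A : Set G}
    (hA : IsDivIdealFull H A) : lq (H : Set G) (lq (H : Set G) A) = A := by
  conv_rhs => rw [hA.2.1, ← lq_eq_rq hN]

/-- A maximal element among the proper non-empty divisorial ideals of `H`. -/
structure IsMaxDiv (H : Submonoid G) (P : Set G) : Prop where
  isDiv : IsDivIdealFull H P
  nonempty : P.Nonempty
  ne : P ≠ H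
  eq_of_subset : ∀ Q, IsDivIdealFull H Q → P ⊆ Q → Q ≠ H → Q = P

lemma exists_isMaxDiv (hv : VNoethFull H) {I : Set G} (hI : IsDivIdealFull H I)
    (hne : I.Nonempty) (hIH : I ≠ H) : ∃ P, IsMaxDiv H P ∧ I ⊆ P := by
  have : WellFoundedGT {A : Set G // IsDivIdealFull H A} := by
    rw [wellFoundedGT_iff_monotone_chain_condition]
    intro f
    obtain ⟨N, hN⟩ := hv (fun n ↦ f n) (fun n ↦ (f n).2) fun n ↦ f.monotone n.le_succ
    exact ⟨N, fun m hm ↦ Subtype.ext (hN m hm).symm⟩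
  obtain ⟨P, hP, hmax⟩ := exists_maximal_of_wellFoundedGT
    (fun A : {A : Set G // IsDivIdealFull H A} ↦ I ⊆ A ∧ (A : Set G) ≠ H) ⟨⟨I, hI⟩, subset_rfl, hIH⟩
  exact ⟨P, ⟨P.2, hne.mono hP.1, hP.2, fun Q hQ hPQ hQH ↦ Set.Subset.antisymm
    (@hmax ⟨Q, hQ⟩ ⟨hP.1.trans hPQ, hQH⟩ hPQ) hPQ⟩, hP.1⟩

namespace IsMaxDiv

variable {P : Set G}

lemma one_notMem (hP : IsMaxDiv H P) : (1 : G) ∉ P := fun h ↦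
  hP.ne (Set.Subset.antisymm hP.isDiv.1.1 fun x hx ↦ by
    simpa using hP.isDiv.1.mul_mem_left hx h)

lemma mem_or_mem (hN : ∀ g : G, ∀ h ∈ H, g * h * g⁻¹ ∈ H) (hP : IsMaxDiv H P) {x y : G}
    (hx : x ∈ H) (hy : y ∈ H) (hxy : x * y ∈ P) : x ∈ P ∨ y ∈ P := by
  by_contra! hcon
  have hPP := hP.isDiv.lq_lq hN
  have hmem : ∀ h, h ∈ lq (H : Set G) (insert 1 ((y * ·) '' lq (H : Set G) P)) ↔
      h ∈ H ∧ h * y ∈ P := fun h ↦ by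
    conv_rhs => rw [← hPP]
    simp only [lq, Set.forall_mem_insert, Set.forall_mem_image, mul_one, mul_assoc, SetLike.mem_coe,
      Set.mem_ofPred_eq]
  have heq := hP.eq_of_subset _ (isDivIdealFull_lq hN (Set.mem_insert 1 _))
    (fun h hh ↦ (hmem h).2 ⟨hP.isDiv.1.1 hh, hP.isDiv.1.mul_mem_right hy hh⟩) fun h ↦ hcon.2 <| by
      have h1 : (1 : G) ∈ (H : Set G) := H.one_mem
      rw [← h, hmem] at h1
      simpa using h1.2
  exact hcon.1 (heq ▸ (hmem x).2 ⟨hx, hxy⟩)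

/-- The complement of a maximal divisorial ideal. -/
def compl (hN : ∀ g : G, ∀ h ∈ H, g * h * g⁻¹ ∈ H) (hP : IsMaxDiv H P) : Submonoid G where
  carrier := {x | x ∈ H ∧ x ∉ P}
  one_mem' := ⟨H.one_mem, hP.one_notMem⟩
  mul_mem' hx hy := ⟨H.mul_mem hx.1 hy.1, fun h ↦
    (hP.mem_or_mem hN hx.1 hy.1 h).elim hx.2 hy.2⟩

lemma mem_normalizer_of_notMem (hN : ∀ g : G, ∀ h ∈ H, g * h * g⁻¹ ∈ H) (hP : IsMaxDiv H P)
    {b : G} (hb : b ∈ H) (hbP : b ∉ P) : b ∈ Subgroup.normalizer P := by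
  rw [Subgroup.mem_set_normalizer_iff]
  refine fun x ↦ ⟨fun hx ↦ ?_, fun hx ↦ ?_⟩
  · refine (hP.mem_or_mem hN (hN b x (hP.isDiv.1.1 hx)) hb ?_).resolve_right hbP
    simpa using hP.isDiv.1.mul_mem_left hb hx
  · have hxH : x ∈ H := by simpa [mul_assoc] using hN b⁻¹ _ (hP.isDiv.1.1 hx)
    refine (hP.mem_or_mem hN hb hxH ?_).resolve_left hbP
    simpa using hP.isDiv.1.mul_mem_right hb hx

lemma normalizer_le (hN : ∀ g : G, ∀ h ∈ H, g * h * g⁻¹ ∈ H) (hP : IsMaxDiv H P) :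
    Subgroup.normalizer P ≤ Subgroup.normalizer (hP.compl hN : Set G) := by
  intro g hg x
  refine and_congr ⟨hN g x, fun h ↦ ?_⟩ (not_congr (hg x))
  simpa [mul_assoc] using hN g⁻¹ _ h

/-- `t` is the inverse of a local parameter at `P`, as witnessed by `p`. -/
structure IsParam (hN : ∀ g : G, ∀ h ∈ H, g * h * g⁻¹ ∈ H) (hP : IsMaxDiv H P) (p t : G) :
    Prop where
  mem : p ∈ P
  mul_mem_compl : p * t ∈ hP.compl hN
  mul_param_mem : ∀ x ∈ P, x * t ∈ H

lemma exists_isParam (hN : ∀ g : G, ∀ h ∈ H, g * h * g⁻¹ ∈ H) (hC : IsCIC H)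
    (hP : IsMaxDiv H P) : ∃ p t, IsParam hN hP p t := by
  by_contra! hcon
  refine hP.ne (Set.Subset.antisymm hP.isDiv.1.1 fun h hh ↦ ?_)
  rw [← hP.isDiv.lq_lq hN]
  intro t ht
  have hmul : ∀ x ∈ P, x * t ∈ H := fun x hx ↦ mul_mem_comm hN (ht x hx)
  have htH : t ∈ rq P P := fun p hp ↦ by
    by_contra hpt
    exact hcon p t ⟨hp, ⟨hmul p hp, hpt⟩, hmul⟩
  rw [(hC P hP.isDiv.1 hP.nonempty).2] at htH
  exact H.mul_mem hh htH

end IsMaxDiv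

namespace IsMaxDiv.IsParam

variable {P : Set G} {hN : ∀ g : G, ∀ h ∈ H, g * h * g⁻¹ ∈ H} {hP : IsMaxDiv H P} {p t : G}

lemma mem_normalizer (ht : IsParam hN hP p t) : t ∈ Subgroup.normalizer P := by
  have hu := hP.mem_normalizer_of_notMem hN ht.mul_mem_compl.1 ht.mul_mem_compl.2
  rw [Subgroup.mem_set_normalizer_iff]
  refine fun x ↦ ⟨fun hx ↦ ?_, fun hx ↦ ?_⟩
  · refine (hP.mem_or_mem hN (hN t x (hP.isDiv.1.1 hx)) ht.mul_mem_compl.1 ?_).resolve_right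
      ht.mul_mem_compl.2
    have hp' := (Subgroup.mem_set_normalizer_iff''.mp hu p).mp ht.mem
    have := hP.isDiv.1.mul_mem_left (mul_mem_comm hN (ht.mul_param_mem x hx)) hp'
    simpa [mul_assoc] using this
  · have hxH : x ∈ H := by simpa [mul_assoc] using hN t⁻¹ _ (hP.isDiv.1.1 hx)
    refine (hP.mem_or_mem hN ht.mul_mem_compl.1 hxH ?_).resolve_left ht.mul_mem_compl.2
    have := hP.isDiv.1.mul_mem_right (ht.mul_param_mem _ hx) ht.mem
    simpa [mul_assoc] using this

lemma mem_normalizer_compl (ht : IsParam hN hP p t) :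
    t ∈ Subgroup.normalizer (hP.compl hN : Set G) :=
  hP.normalizer_le hN ht.mem_normalizer

lemma mem_normalizer_compl_left (ht : IsParam hN hP p t) :
    p ∈ Subgroup.normalizer (hP.compl hN : Set G) := by
  have hu := hP.mem_normalizer_of_notMem hN ht.mul_mem_compl.1 ht.mul_mem_compl.2
  simpa using mul_mem (hP.normalizer_le hN hu) (inv_mem ht.mem_normalizer_compl)

lemma pow_mul_pow_mem (ht : IsParam hN hP p t) (k : ℕ) : p ^ k * t ^ k ∈ hP.compl hN := by
  induction k with
  | zero => simp [one_mem]
  | succ k ih =>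
    have := (Subgroup.mem_set_normalizer_iff''.mp (pow_mem ht.mem_normalizer_compl k) _).mp
      ht.mul_mem_compl
    have := mul_mem ih this
    rw [pow_succ, pow_succ']
    simpa [mul_assoc] using this

lemma le_of_mul_pow_mem (ht : IsParam hN hP p t) {a : G} {m n : ℕ}
    (hm : a * t ^ m ∈ hP.compl hN) (hn : a * t ^ n ∈ hP.compl hN) : n ≤ m := by
  by_contra! hlt
  obtain ⟨k, rfl⟩ := Nat.exists_eq_add_of_lt hlt
  have hconj := (Subgroup.mem_set_normalizer_iff.mp
    (pow_mem ht.mem_normalizer_compl_left (k + 1)) _).mp hm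
  have hmem := mul_mem hconj (ht.pow_mul_pow_mem (k + 1))
  have hpk : p ^ (k + 1) ∈ P := by
    rw [pow_succ]
    exact hP.isDiv.1.mul_mem_left (pow_mem (hP.isDiv.1.1 ht.mem) k) ht.mem
  refine hmem.2 ?_
  have := hP.isDiv.1.mul_mem_right hn.1 hpk
  rw [add_assoc, pow_add t] at this
  simpa [mul_assoc] using this

lemma exists_mul_pow_mem (ht : IsParam hN hP p t) (hC : IsCIC H) {a : G} (ha : a ∈ H) :
    ∃ n : ℕ, a * t ^ n ∈ hP.compl hN := by
  by_contra! hcon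
  have hall : ∀ n : ℕ, a * t ^ n ∈ H := fun n ↦ by
    induction n with
    | zero => simpa using ha
    | succ n ih =>
      rw [pow_succ, ← mul_assoc]
      exact ht.mul_param_mem _ (by_contra fun h ↦ hcon n ⟨ih, h⟩)
  have hJ : IsIdeal H (lq (H : Set G) (Set.range fun n : ℕ ↦ t ^ n)) :=
    (isDivIdealFull_lq hN (Set.mem_range.mpr ⟨0, pow_zero t⟩)).1
  have htJ : t ∈ rq (lq (H : Set G) (Set.range fun n : ℕ ↦ t ^ n))
      (lq (H : Set G) (Set.range fun n : ℕ ↦ t ^ n)) := by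
    rintro x hx _ ⟨n, rfl⟩
    simpa [mul_assoc, ← pow_succ'] using hx _ ⟨n + 1, rfl⟩
  rw [(hC _ hJ ⟨a, by rintro _ ⟨n, rfl⟩; exact hall n⟩).2] at htJ
  exact ht.mul_mem_compl.2 (hP.isDiv.1.mul_mem_right htJ ht.mem)

lemma mul_mul_pow_add_mem (ht : IsParam hN hP p t) {a b : G} {m n : ℕ}
    (ha : a * t ^ m ∈ hP.compl hN) (hb : b * t ^ n ∈ hP.compl hN) :
    a * b * t ^ (m + n) ∈ hP.compl hN := by
  have := mul_mem ha ((Subgroup.mem_set_normalizer_iff''.mp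
    (pow_mem ht.mem_normalizer_compl m) _).mp hb)
  rw [add_comm, pow_add]
  simpa [mul_assoc] using this

/-- If `b` has value at most that of `a`, then `b⁻¹ * a` lies in the localization at `P`. -/
lemma exists_mul_inv_mul_mem (ht : IsParam hN hP p t) {a b : G} {m n : ℕ} (hnm : n ≤ m)
    (ha : a * t ^ m ∈ hP.compl hN) (hb : b * t ^ n ∈ hP.compl hN) :
    ∃ s ∈ hP.compl hN, s * (b⁻¹ * a) ∈ H := by
  obtain ⟨k, rfl⟩ := Nat.exists_eq_add_of_le hnm
  have hw := ht.pow_mul_pow_mem k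
  set w := p ^ k * t ^ k with hw_def
  have hs := (Subgroup.mem_set_normalizer_iff.mp (pow_mem ht.mem_normalizer_compl n) _).mp
    (mul_mem hw hb)
  refine ⟨_, hs, ?_⟩
  have hr := hN (t ^ n) _ (H.mul_mem (hN w _ ha.1) (pow_mem (hP.isDiv.1.1 ht.mem) k))
  convert hr using 1
  have hp : p ^ k = w * (t ^ k)⁻¹ := by simp [hw_def]
  rw [hp, add_comm, pow_add]
  group

end IsMaxDiv.IsParam

lemma finite_isMaxDiv_mem (hN : ∀ g : G, ∀ h ∈ H, g * h * g⁻¹ ∈ H) (hv : VNoethFull H) (a : G) :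
    {P : Set G | IsMaxDiv H P ∧ a ∈ P}.Finite := by
  by_contra hinf
  let Q := Set.Infinite.natEmbedding _ hinf
  have hQ : ∀ i, IsMaxDiv H (Q i : Set G) := fun i ↦ (Q i).2.1
  let I : ℕ → Set G := fun n ↦ ⋂ i ≤ n, (Q i : Set G)
  have hIdiv : ∀ n, lq (H : Set G) (lq (H : Set G) (I n)) = I n := fun n ↦ by
    refine Set.Subset.antisymm (fun x hx ↦ ?_) fun x hx y hy ↦ mul_mem_comm hN (hy x hx)
    refine Set.mem_iInter₂.mpr fun i hi ↦ ?_
    rw [← (hQ i).isDiv.lq_lq hN]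
    exact fun y hy ↦ hx y fun z hz ↦ hy z (Set.mem_iInter₂.mp hz i hi)
  have hanti : ∀ n, I (n + 1) ⊆ I n := fun n x hx ↦
    Set.mem_iInter₂.mpr fun i hi ↦ Set.mem_iInter₂.mp hx i (hi.trans n.le_succ)
  obtain ⟨N, hstab⟩ := hv (fun n ↦ lq (H : Set G) ((a⁻¹ * ·) '' I n))
    (fun n ↦ isDivIdealFull_lq hN
      ⟨a, Set.mem_iInter₂.mpr fun i _ ↦ (Q i).2.2, inv_mul_cancel a⟩)
    fun n x hx b hb ↦ hx b (Set.image_mono (hanti n) hb)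
  have hmem : ∀ n y, y * a ∈ lq (H : Set G) ((a⁻¹ * ·) '' I n) ↔ y ∈ lq (H : Set G) (I n) :=
    fun n y ↦ by
      simp only [lq, Set.mem_ofPred_eq, Set.forall_mem_image, mul_assoc, mul_inv_cancel_left]
  have hlq : lq (H : Set G) (I (N + 1)) = lq (H : Set G) (I N) := by
    ext y
    rw [← hmem, ← hmem]
    exact Set.ext_iff.mp (hstab (N + 1) N.le_succ) _
  have hIN : I N = I (N + 1) := by rw [← hIdiv N, ← hIdiv (N + 1), hlq]
  have hsep : ∀ i ≤ N, ∃ x ∈ (Q i : Set G), x ∉ (Q (N + 1) : Set G) := fun i hi ↦ by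
    by_contra! hsub
    have := (hQ i).eq_of_subset _ (hQ (N + 1)).isDiv hsub (hQ (N + 1)).ne
    have := Q.injective (Subtype.ext this)
    omega
  have hprod : ∀ n ≤ N, ∃ x ∈ I n, x ∉ (Q (N + 1) : Set G) := fun n hn ↦ by
    induction n with
    | zero =>
      obtain ⟨x, hx, hxN⟩ := hsep 0 hn
      exact ⟨x, by simpa [I] using hx, hxN⟩
    | succ n ih =>
      obtain ⟨x, hx, hxN⟩ := ih (by omega)
      obtain ⟨y, hy, hyN⟩ := hsep (n + 1) hn
      have hxH : x ∈ H := (hQ 0).isDiv.1.1 (Set.mem_iInter₂.mp hx 0 n.zero_le)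
      have hyH : y ∈ H := (hQ (n + 1)).isDiv.1.1 hy
      refine ⟨x * y, Set.mem_iInter₂.mpr fun i hi ↦ ?_, fun h ↦
        ((hQ (N + 1)).mem_or_mem hN hxH hyH h).elim hxN hyN⟩
      rcases Nat.le_succ_iff.mp hi with hi | rfl
      · exact (hQ i).isDiv.1.mul_mem_right hyH (Set.mem_iInter₂.mp hx i hi)
      · exact (hQ (n + 1)).isDiv.1.mul_mem_left hxH hy
  obtain ⟨x, hx, hxN⟩ := hprod N le_rfl
  rw [hIN] at hx
  exact hxN (Set.mem_iInter₂.mp hx (N + 1) le_rfl)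

end Normalizing

lemma exists_divisorHom {G : Type u} [Group G] {H : Submonoid G}
    (hN : ∀ g : G, ∀ h ∈ H, g * h * g⁻¹ ∈ H) (hK : IsKrull H) :
    ∃ (P : Type u) (φ : H → (P →₀ ℕ)), (∀ a b : H, φ (a * b) = φ a + φ b) ∧
      ∀ v u : H, φ u ≤ φ v → (u : G)⁻¹ * v ∈ H := by
  obtain ⟨hC, hv⟩ := hK
  choose p t ht using fun P : {P : Set G // IsMaxDiv H P} ↦ P.2.exists_isParam hN hC
  choose val hval using fun (P : {P : Set G // IsMaxDiv H P}) (a : H) ↦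
    (ht P).exists_mul_pow_mem hC a.2
  have huniq : ∀ P (a : H) n, (a : G) * t P ^ n ∈ P.2.compl hN → val P a = n := fun P a n h ↦
    le_antisymm ((ht P).le_of_mul_pow_mem h (hval P a)) ((ht P).le_of_mul_pow_mem (hval P a) h)
  have hfin : ∀ a : H, (Function.support fun P ↦ val P a).Finite := fun a ↦ by
    refine ((finite_isMaxDiv_mem hN hv a).preimage Subtype.val_injective.injOn).subset
      fun P hPa ↦ ⟨P.2, ?_⟩
    by_contra haP
    exact hPa (huniq P a 0 (by simpa using ⟨a.2, haP⟩))
  refine ⟨{P : Set G // IsMaxDiv H P},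
    fun a ↦ Finsupp.ofSupportFinite (fun P ↦ val P a) (hfin a), fun a b ↦ ?_, fun v u huv ↦ ?_⟩
  · ext P
    exact huniq P (a * b) _ ((ht P).mul_mul_pow_add_mem (hval P a) (hval P b))
  · by_contra hcon
    have hI := isDivIdealFull_lq hN (Set.mem_insert 1 {(u : G)⁻¹ * v})
    have hmem : ∀ h, h ∈ lq (H : Set G) {1, (u : G)⁻¹ * v} ↔
        h ∈ H ∧ h * ((u : G)⁻¹ * v) ∈ H := fun h ↦ by simp [lq]
    obtain ⟨P, hP, hIP⟩ := exists_isMaxDiv hv hI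
      ⟨u, (hmem _).2 ⟨u.2, by simp⟩⟩ fun h ↦ hcon <| by
        have h1 : (1 : G) ∈ (H : Set G) := H.one_mem
        rw [← h, hmem] at h1
        simpa using h1.2
    obtain ⟨s, hs, hsx⟩ := (ht ⟨P, hP⟩).exists_mul_inv_mul_mem (huv ⟨P, hP⟩)
      (hval ⟨P, hP⟩ v) (hval ⟨P, hP⟩ u)
    exact hs.2 (hIP ((hmem s).2 ⟨hs.1, hsx⟩))

/-- A monoid `H` admits a divisor homomorphism into a free abelian monoid
`F(P)` (finitely supported functions `P → ℕ`) if and only if `H` is a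
normalizing Krull monoid. -/
theorem stmt16 {G : Type u} [Group G] (H : Submonoid G) (hq : IsQG H) :
    (∃ (P : Type u) (φ : ↥H → (P →₀ ℕ)),
      φ 1 = 0 ∧ (∀ a b : ↥H, φ (a * b) = φ a + φ b) ∧
      (∀ v u : ↥H,
        ((∃ d : P →₀ ℕ, φ v = φ u + d) → ∃ h : ↥H, v = u * h) ∧
        ((∃ d : P →₀ ℕ, φ v = d + φ u) → ∃ h : ↥H, v = h * u))) ↔
    ((∀ a ∈ H, ({a} : Set G) * (H : Set G) = (H : Set G) * {a}) ∧ IsKrull H) := by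
  constructor
  · rintro ⟨P, φ, -, hmul, hdiv⟩
    have hleft : ∀ v u : H, φ u ≤ φ v → ∃ h : H, v = u * h := fun v u h ↦
      (hdiv v u).1 ⟨φ v - φ u, (add_tsub_cancel_of_le h).symm⟩
    have hright : ∀ v u : H, φ u ≤ φ v → ∃ h : H, v = h * u := fun v u h ↦
      (hdiv v u).2 ⟨φ v - φ u, (tsub_add_cancel_of_le h).symm⟩
    exact ⟨fun a ha ↦ singleton_mul_eq_of_divisorHom hmul hleft hright ha,
      isCIC_of_divisorHom hq hmul hleft hright, vNoethFull_of_divisorHom hq hmul hright⟩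
  · rintro ⟨hn, hK⟩
    have hN : ∀ g : G, ∀ h ∈ H, g * h * g⁻¹ ∈ H := fun g h hh ↦ conj_mem_of_normalizing hq hn g hh
    obtain ⟨P, φ, hmul, hdiv⟩ := exists_divisorHom hN hK
    refine ⟨P, φ, by simpa using hmul 1 1, hmul, fun v u ↦ ⟨?_, ?_⟩⟩
    · rintro ⟨d, hd⟩
      exact ⟨⟨_, hdiv v u (hd ▸ le_self_add)⟩, by ext; simp⟩
    · rintro ⟨d, hd⟩
      exact ⟨⟨_, mul_mem_comm hN (hdiv v u (hd ▸ le_add_self))⟩, by ext; simp⟩
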